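/- Let B be a real Banach space, V ⊆ B a closed subspace, and (L_n)_{n∈ℤ} bounded linear operators on B with L_n(V) ⊆ V, satisfying exponential loss of memory on V: there are C ≥ 1 and ρ ∈ (0,1) with ‖L_{n−1} ∘ ⋯ ∘ L_m v‖ ≤ C ρ^{n−m} ‖v‖ for all m < n and v ∈ V. Let (g_n)_{n∈ℤ} be a sequence in V with G := sup_{n∈ℤ} ‖g_n‖ < ∞. Then for each n ∈ ℤ the series η_n := Σ_{k=0}^∞ L_{n−1} ∘ ⋯ ∘ L_{n−k} g_{n−k−1} (k = 0 term equal to g_{n−1}) converges absolutely in B, with Σ_{k=0}^∞ ‖L_{n−1} ∘ ⋯ ∘ L_{n−k} g_{n−k−1}‖ ≤ (1 + Cρ/(1−ρ)) G for every n, each η_n belongs to V, sup_n ‖η_n‖ < ∞, and the sequence (η_n) satisfies η_{n+1} = L_n η_n + g_n for all n ∈ ℤ. -/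

import Mathlib

/-- `backComp L n k = L (n−1) ∘ ⋯ ∘ L (n−k)` : composition of `k` operators,
with `L (n−k)` applied first; `backComp L n 0` is the identity. -/
noncomputable def backComp {B : Type*} [NormedAddCommGroup B] [NormedSpace ℝ B]
    (L : ℤ → (B →L[ℝ] B)) (n : ℤ) : ℕ → (B →L[ℝ] B)
  | 0 => 1
  | (k + 1) => backComp L n k ∘L L (n - ((k : ℤ) + 1))

theorem backComp_add_one_succ {B : Type*} [NormedAddCommGroup B] [NormedSpace ℝ B]
    (L : ℤ → (B →L[ℝ] B)) (n : ℤ) (k : ℕ) :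
    backComp L (n + 1) (k + 1) = L n ∘L backComp L n k := by
  induction k with
  | zero =>
    ext x
    simp [backComp]
  | succ k ih =>
    rw [backComp, ih, backComp, ContinuousLinearMap.comp_assoc]
    congr 3
    push_cast
    ring

theorem backComp_mem {B : Type*} [NormedAddCommGroup B] [NormedSpace ℝ B]
    {V : Submodule ℝ B} {L : ℤ → (B →L[ℝ] B)} (hinv : ∀ n : ℤ, ∀ v ∈ V, L n v ∈ V)
    (n : ℤ) (k : ℕ) {v : B} (hv : v ∈ V) : backComp L n k v ∈ V := by
  induction k generalizing v with
  | zero => exact hv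
  | succ k ih => exact ih (hinv _ v hv)

/-- A nonnegative sequence with first term at most `G` and geometrically bounded tail is
summable, with the corresponding bound on its sum. -/
theorem summable_and_tsum_le_of_geometric_tail {a : ℕ → ℝ} {C ρ G : ℝ} (hρ0 : 0 ≤ ρ)
    (hρ1 : ρ < 1) (ha : ∀ k, 0 ≤ a k) (h0 : a 0 ≤ G)
    (hsucc : ∀ k, a (k + 1) ≤ C * ρ ^ (k + 1) * G) :
    Summable a ∧ ∑' k, a k ≤ (1 + C * ρ / (1 - ρ)) * G := by
  have hgeom : HasSum (fun k : ℕ => C * ρ ^ (k + 1) * G) (C * ρ / (1 - ρ) * G) := by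
    have h := ((hasSum_geometric_of_lt_one hρ0 hρ1).mul_left (C * ρ)).mul_right G
    simpa only [pow_succ', mul_assoc, div_eq_mul_inv] using h
  have htail : Summable fun k => a (k + 1) :=
    Summable.of_nonneg_of_le (fun k => ha _) hsucc hgeom.summable
  have hsum : Summable a := (summable_nat_add_iff 1).1 htail
  refine ⟨hsum, ?_⟩
  rw [hsum.tsum_eq_zero_add, add_mul, one_mul]
  exact add_le_add h0 (hasSum_le hsucc htail.hasSum hgeom)

/-- Causal series representation of the linear response: under exponential loss of
memory on the closed invariant subspace `V` and a uniformly bounded forcing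
`(g_n) ⊆ V`, the series `η_n = Σ_{k≥0} L_{n−1} ⋯ L_{n−k} g_{n−k−1}` converges
absolutely with `Σ_k ‖·‖ ≤ (1 + Cρ/(1−ρ)) G`, each `η_n ∈ V`, `sup_n ‖η_n‖ < ∞`,
and `η_{n+1} = L_n η_n + g_n` for all `n`. -/
theorem causal_series_linear_response
    {B : Type*} [NormedAddCommGroup B] [NormedSpace ℝ B] [CompleteSpace B]
    (V : Submodule ℝ B) (hVclosed : IsClosed (V : Set B))
    (L : ℤ → (B →L[ℝ] B))
    (hinv : ∀ (n : ℤ), ∀ v ∈ V, L n v ∈ V)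
    (C ρ : ℝ) (hC : 1 ≤ C) (hρ : ρ ∈ Set.Ioo (0 : ℝ) 1)
    (hELoM : ∀ (m n : ℤ), m < n → ∀ v ∈ V,
      ‖backComp L n ((n - m).toNat) v‖ ≤ C * ρ ^ ((n - m).toNat) * ‖v‖)
    (g : ℤ → B) (hgV : ∀ n : ℤ, g n ∈ V)
    (G : ℝ) (hG : ∀ n : ℤ, ‖g n‖ ≤ G) :
    (∀ n : ℤ, Summable (fun k : ℕ => ‖backComp L n k (g (n - (k : ℤ) - 1))‖)) ∧
    (∀ n : ℤ, Summable (fun k : ℕ => backComp L n k (g (n - (k : ℤ) - 1)))) ∧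
    (∀ n : ℤ, ∑' k : ℕ, ‖backComp L n k (g (n - (k : ℤ) - 1))‖ ≤ (1 + C * ρ / (1 - ρ)) * G) ∧
    (∀ n : ℤ, (∑' k : ℕ, backComp L n k (g (n - (k : ℤ) - 1))) ∈ V) ∧
    (∃ Mη : ℝ, ∀ n : ℤ, ‖∑' k : ℕ, backComp L n k (g (n - (k : ℤ) - 1))‖ ≤ Mη) ∧
    (∀ n : ℤ, (∑' k : ℕ, backComp L (n + 1) k (g (n + 1 - (k : ℤ) - 1))) =
      L n (∑' k : ℕ, backComp L n k (g (n - (k : ℤ) - 1))) + g n) := by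
  have hterm (n : ℤ) := summable_and_tsum_le_of_geometric_tail (C := C) (G := G)
    (a := fun k : ℕ => ‖backComp L n k (g (n - (k : ℤ) - 1))‖) hρ.1.le hρ.2
    (fun _ => norm_nonneg _) (hG _) (fun k => by
      have h := hELoM (n - (k + 1 : ℕ)) n (by omega) _ (hgV (n - ((k + 1 : ℕ) : ℤ) - 1))
      rw [sub_sub_cancel, Int.toNat_natCast] at h
      refine h.trans (mul_le_mul_of_nonneg_left (hG _) ?_)
      have := hρ.1
      positivity)
  have hsum (n : ℤ) : Summable fun k : ℕ => backComp L n k (g (n - (k : ℤ) - 1)) :=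
    (hterm n).1.of_norm
  refine ⟨fun n => (hterm n).1, hsum, fun n => (hterm n).2, fun n => ?_,
    ⟨(1 + C * ρ / (1 - ρ)) * G, fun n => (norm_tsum_le_tsum_norm (hterm n).1).trans (hterm n).2⟩,
    fun n => ?_⟩
  · exact hVclosed.mem_of_tendsto (hsum n).hasSum
      (.of_forall fun s => V.sum_mem fun k _ => backComp_mem hinv n k (hgV _))
  · rw [(hsum (n + 1)).tsum_eq_zero_add, (L n).map_tsum (hsum n), add_comm]
    congr 1
    · refine tsum_congr fun k => ?_
      rw [backComp_add_one_succ, ContinuousLinearMap.comp_apply]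
      congr 3
      push_cast
      ring
    · simp [backComp]
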